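/- arXiv:2009.05095 — 2 statements merged into one kernel-verified Lean document; each statement's English description precedes it below -/
import Mathlib

section
/- Let A be a traceless operator on the first k' sites with ‖A‖ = 1, and suppose H_N ≠ 0 for some sufficiently large N, so that τ_h = tr(H_N h)/d > 0 and τ_A = tr(H_N A)/d are N-independent constants for large N. Assume the following eigenstate thermalization hypothesis: there are constants ε ∈ (0,1), M ≥ 0, K ≥ 0 and, for each N, a function g_N : [−ε,ε] → {z ∈ ℂ : |z| ≤ 1} together with complex numbers a_N, b_N, c_N with |a_N|, |b_N|, |c_N| ≤ M such that |g_N(x) − a_N − b_N x − (c_N/2)x²| ≤ M|x|³ for all x ∈ [−ε,ε], and |⟨j|A|j⟩ − g_N(E_j/N)| ≤ K/N² for every j with |E_j| ≤ Nε. Then there is a constant C such that |b_N − τ_A/τ_h| ≤ C/N for all sufficiently large N (i.e., g_N'(0) = tr(HA)/tr(Hh) + O(1/N)). -/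
open Matrix MeasureTheory Filter

/-- The space of operators on a chain of `N` qudits, each of local dimension `dloc`. -/
abbrev Op (dloc N : ℕ) := Matrix (Fin N → Fin dloc) (Fin N → Fin dloc) ℂ

/-- Cyclic translation of qudit configurations: site `i` of the new configuration carries
the value of site `i - 1` of the old one. -/
def confShift (dloc N : ℕ) : Equiv.Perm (Fin N → Fin dloc) :=
  Equiv.arrowCongr (finRotate N) (Equiv.refl (Fin dloc))

/-- The translation operator `T` on a chain of `N` qudits, as a permutation matrix. -/
noncomputable def Tmat (dloc N : ℕ) : Op dloc N :=
  fun x y => if x = confShift dloc N y then 1 else 0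

/-- Extension of an operator on the first `m` sites to the `N`-site chain, by tensoring
with the identity on the remaining sites (the zero operator if `m > N`). -/
noncomputable def embed (dloc m N : ℕ) (a : Op dloc m) : Op dloc N :=
  if hm : m ≤ N then
    (fun x y => a (fun i => x (Fin.castLE hm i)) (fun i => y (Fin.castLE hm i)) *
      (if ∀ i : Fin N, m ≤ (i : ℕ) → x i = y i then 1 else 0))
  else 0

/-- The translation-invariant Hamiltonian `H_N = ∑_{l=0}^{N-1} T^l h T^{-l}` built from
a local term `h` on `k` sites. -/
noncomputable def Ham (dloc k N : ℕ) (h : Op dloc k) : Op dloc N :=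
  ∑ l : Fin N, Tmat dloc N ^ (l : ℕ) * embed dloc k N h * (Tmat dloc N)ᴴ ^ (l : ℕ)

/-- The operator norm (ℓ²→ℓ² norm) of a matrix. -/
noncomputable def opNorm {n : Type*} [Fintype n] [DecidableEq n] (A : Matrix n n ℂ) : ℝ :=
  ‖Matrix.toEuclideanCLM (𝕜 := ℂ) (n := n) A‖

/-- An orthonormal basis of simultaneous eigenvectors of the Hamiltonian `H` (with real
eigenvalues `E j`) and of the translation operator `T` (with eigenvalues `τ j`). -/
structure EigData (dloc N : ℕ) (H : Op dloc N) where
  v : (Fin N → Fin dloc) → ((Fin N → Fin dloc) → ℂ)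
  E : (Fin N → Fin dloc) → ℝ
  τ : (Fin N → Fin dloc) → ℂ
  orth : ∀ j j', star (v j) ⬝ᵥ v j' = if j = j' then 1 else 0
  eigH : ∀ j, H.mulVec (v j) = (E j : ℂ) • v j
  eigT : ∀ j, (Tmat dloc N).mulVec (v j) = τ j • v j

/-- The eigenstate expectation value `⟨j|B|j⟩`. -/
noncomputable def eev {dloc N : ℕ} {H : Op dloc N} (D : EigData dloc N H)
    (B : Op dloc N) (j : Fin N → Fin dloc) : ℂ :=
  star (D.v j) ⬝ᵥ B.mulVec (D.v j)

/-- `r_f(N) = ((1/d) ∑_j |⟨j|B|j⟩ - f(E_j/N)|²)^{1/2}`. -/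
noncomputable def rf {dloc N : ℕ} {H : Op dloc N} (D : EigData dloc N H)
    (B : Op dloc N) (f : ℝ → ℂ) : ℝ :=
  Real.sqrt ((1 / (dloc : ℝ) ^ N) * ∑ j, ‖eev D B j - f (D.E j / N)‖ ^ 2)

/-- A function `f : [-1,1] → {z : ℂ, |z| ≤ 1}` (encoded as a total function on `ℝ`)
is smooth with Taylor data `c0 = f(0)`, `c1 = f'(0)`, `c2 = f''(0)` and remainder
constant `M` if `|f(x) - c0 - c1 x - (c2/2) x²| ≤ M |x|³` on `[-1,1]`. -/
def SmoothFn (f : ℝ → ℂ) (c0 c1 c2 : ℂ) (M : ℝ) : Prop :=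
  0 ≤ M ∧ (∀ x ∈ Set.Icc (-1 : ℝ) 1, ‖f x‖ ≤ 1) ∧
    ∀ x ∈ Set.Icc (-1 : ℝ) 1, ‖f x - c0 - c1 * x - c2 / 2 * x ^ 2‖ ≤ M * |x| ^ 3

/-- The generalized Pauli string `X^{a_1}Z^{b_1} ⊗ ⋯ ⊗ X^{a_m}Z^{b_m}` on `m` qudits,
where `X|x⟩ = |x+1 mod dloc⟩` and `Z|x⟩ = ω^x |x⟩` with `ω = exp(2πi/dloc)`. -/
noncomputable def pauli (dloc m : ℕ) (a b : Fin m → Fin dloc) : Op dloc m :=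
  fun x y =>
    if ∀ i, (x i : ℕ) = ((y i : ℕ) + (a i : ℕ)) % dloc then
      ∏ i, Complex.exp (2 * Real.pi * Complex.I * (b i : ℕ) * (y i : ℕ) / dloc)
    else 0

/-- An operator on `k` sites is canonical if every generalized Pauli string with nonzero
coefficient in its expansion acts nontrivially on site 1. -/
def Canonical (dloc k : ℕ) (h : Op dloc k) : Prop :=
  ∀ a b : Fin k → Fin dloc,
    (∀ i : Fin k, (i : ℕ) = 0 → (a i : ℕ) = 0 ∧ (b i : ℕ) = 0) →
      Matrix.trace ((pauli dloc k a b)ᴴ * h) = 0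

/-- An operator on `k` sites is exactly `k`-local if some generalized Pauli string with
nonzero coefficient in its expansion acts nontrivially on site `k`. -/
def ExactlyLocal (dloc k : ℕ) (h : Op dloc k) : Prop :=
  ∃ a b : Fin k → Fin dloc, ∃ i : Fin k, (i : ℕ) = k - 1 ∧ ((a i : ℕ) ≠ 0 ∨ (b i : ℕ) ≠ 0) ∧
    Matrix.trace ((pauli dloc k a b)ᴴ * h) ≠ 0

/-- The submodule (over `ℝ`) of traceless operators on `k'` sites. -/
noncomputable def tracelessOps (dloc k' : ℕ) : Submodule ℝ (Op dloc k') :=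
  LinearMap.ker ((Matrix.traceLinearMap (Fin k' → Fin dloc) ℂ ℂ).restrictScalars ℝ)

/-- The translation average `𝔸 = (1/N) ∑_{l=0}^{N-1} T^l A T^{-l}` of an operator. -/
noncomputable def tavg (dloc N : ℕ) (A : Op dloc N) : Op dloc N :=
  ((N : ℂ))⁻¹ • ∑ l : Fin N, Tmat dloc N ^ (l : ℕ) * A * (Tmat dloc N)ᴴ ^ (l : ℕ)

open scoped Kronecker

noncomputable section

section SiteLift

variable {ι κ μ : Type} [Fintype ι] [Fintype κ] [Fintype μ]
  [DecidableEq ι] [DecidableEq κ] [DecidableEq μ] {q : ℕ}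

/-- Splitting a configuration on `κ` into its restriction along `f` and the rest. -/
def splitEquiv (q : ℕ) (f : ι ↪ κ) :
    (κ → Fin q) ≃ (ι → Fin q) × ({i // i ∉ Set.range f} → Fin q) :=
  (Equiv.piEquivPiSubtypeProd (· ∈ Set.range f) (fun _ => Fin q)).trans
    (Equiv.prodCongr
      (Equiv.arrowCongr (Equiv.ofInjective f f.injective).symm (Equiv.refl _)) (Equiv.refl _))

lemma trace_submatrix_equiv {m n : Type} [Fintype m] [Fintype n] (e : m ≃ n)
    (X : Matrix n n ℂ) : (X.submatrix e e).trace = X.trace :=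
  Equiv.sum_comp e fun i => X i i

lemma splitEquiv_apply (f : ι ↪ κ) (x : κ → Fin q) :
    splitEquiv q f x = (fun i => x (f i), fun i : {i // i ∉ Set.range f} => x i) := rfl

/-- The operator `X` acting on the sites in the range of `f`, tensored with the identity
on all other sites. -/
def siteLift (f : ι ↪ κ) :
    Matrix (ι → Fin q) (ι → Fin q) ℂ →⋆ₐ[ℂ] Matrix (κ → Fin q) (κ → Fin q) ℂ where
  toFun X := (X ⊗ₖ (1 : Matrix ({i // i ∉ Set.range f} → Fin q) _ ℂ)).submatrix
    (splitEquiv q f) (splitEquiv q f)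
  map_one' := by simp
  map_mul' X Y := by
    rw [Matrix.submatrix_mul_equiv, ← Matrix.mul_kronecker_mul, one_mul]
  map_zero' := by simp
  map_add' X Y := by rw [Matrix.add_kronecker, Matrix.submatrix_add]; rfl
  commutes' c := by
    simp [Algebra.algebraMap_eq_smul_one, Matrix.smul_kronecker, Matrix.submatrix_smul]
  map_star' X := by
    simp [Matrix.star_eq_conjTranspose, Matrix.conjTranspose_kronecker]

lemma siteLift_eq (f : ι ↪ κ) (X : Matrix (ι → Fin q) (ι → Fin q) ℂ) :
    siteLift f X = (X ⊗ₖ (1 : Matrix ({i // i ∉ Set.range f} → Fin q) _ ℂ)).submatrix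
      (splitEquiv q f) (splitEquiv q f) := rfl

lemma siteLift_apply (f : ι ↪ κ) (X : Matrix (ι → Fin q) (ι → Fin q) ℂ) (x y : κ → Fin q) :
    siteLift f X x y = X (fun i => x (f i)) (fun i => y (f i)) *
      (if ∀ i, i ∉ Set.range f → x i = y i then 1 else 0) := by
  simp only [siteLift_eq, Matrix.submatrix_apply, Matrix.kronecker_apply, splitEquiv_apply,
    Matrix.one_apply, funext_iff, Subtype.forall]

lemma siteLift_siteLift (f : ι ↪ κ) (g : κ ↪ μ) (X : Matrix (ι → Fin q) (ι → Fin q) ℂ) :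
    siteLift g (siteLift f X) = siteLift (f.trans g) X := by
  ext x y
  simp only [siteLift_apply, Function.Embedding.trans_apply, ← ite_and, mul_ite,
    mul_one, mul_zero]
  congr 1
  simp only [eq_iff_iff, Set.mem_range, not_exists, Function.Embedding.trans_apply]
  constructor
  · rintro ⟨h1, h2⟩ i hi
    by_cases hg : ∃ j, g j = i
    · obtain ⟨j, rfl⟩ := hg
      exact h2 j fun l hl => hi l (by rw [hl])
    · exact h1 i (not_exists.mp hg)
  · intro hh
    exact ⟨fun i hi => hh i fun l => hi _, fun i hi => hh _ fun l hl => hi l (g.injective hl)⟩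

/-- The normalized trace. -/
def ntr {n : Type} [Fintype n] (X : Matrix n n ℂ) : ℂ := X.trace / Fintype.card n

lemma trace_siteLift (f : ι ↪ κ) (X : Matrix (ι → Fin q) (ι → Fin q) ℂ) :
    (siteLift f X).trace = X.trace * Fintype.card ({i // i ∉ Set.range f} → Fin q) := by
  rw [siteLift_eq, trace_submatrix_equiv, Matrix.trace_kronecker, Matrix.trace_one]

lemma ntr_siteLift [NeZero q] (f : ι ↪ κ) (X : Matrix (ι → Fin q) (ι → Fin q) ℂ) :
    ntr (siteLift f X) = ntr X := by
  have h1 := Fintype.card_congr (splitEquiv q f)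
  rw [ntr, ntr, trace_siteLift, h1, Fintype.card_prod, Nat.cast_mul]
  exact mul_div_mul_right _ _ (Nat.cast_ne_zero.mpr Fintype.card_ne_zero)

/-- Operators supported away from the range of `f`. -/
def awayFrom (q : ℕ) (f : ι ↪ κ) : StarSubalgebra ℂ (Matrix (κ → Fin q) (κ → Fin q) ℂ) :=
  (siteLift (Function.Embedding.subtype (· ∉ Set.range f))).range

lemma siteLift_mem_awayFrom (f : ι ↪ κ) (g : μ ↪ κ) (hfg : ∀ i j, f i ≠ g j)
    (Y : Matrix (μ → Fin q) (μ → Fin q) ℂ) : siteLift g Y ∈ awayFrom q f := by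
  have hg : ∀ j, g j ∉ Set.range f := fun j ⟨i, hi⟩ => hfg i j hi
  refine ⟨siteLift ⟨fun j => ⟨g j, hg j⟩, fun a b hab => g.injective (by simpa using hab)⟩ Y, ?_⟩
  exact siteLift_siteLift _ _ _

lemma trace_siteLift_mul_eq_zero (f : ι ↪ κ) {X : Matrix (ι → Fin q) (ι → Fin q) ℂ}
    (hX : X.trace = 0) {B : Matrix (κ → Fin q) (κ → Fin q) ℂ} (hB : B ∈ awayFrom q f) :
    (siteLift f X * B).trace = 0 := by
  obtain ⟨Y, rfl⟩ := hB
  have key : siteLift (Function.Embedding.subtype (· ∉ Set.range f)) Y =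
      ((1 : Matrix (ι → Fin q) _ ℂ) ⊗ₖ Y).submatrix (splitEquiv q f) (splitEquiv q f) := by
    ext x y
    rw [siteLift_apply, Matrix.submatrix_apply, Matrix.kronecker_apply, mul_comm]
    congr 1
    simp [splitEquiv_apply, Matrix.one_apply, funext_iff]
  erw [key]
  rw [siteLift_eq, Matrix.submatrix_mul_equiv, ← Matrix.mul_kronecker_mul,
    trace_submatrix_equiv, Matrix.trace_kronecker, mul_one, hX, zero_mul]

lemma trace_siteLift_mul_siteLift_trans [NeZero q] (e : Equiv.Perm κ) (f : ι ↪ κ) (g : μ ↪ κ)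
    (X : Matrix (ι → Fin q) (ι → Fin q) ℂ) (Y : Matrix (μ → Fin q) (μ → Fin q) ℂ) :
    (siteLift (f.trans e.toEmbedding) X * siteLift (g.trans e.toEmbedding) Y).trace =
      (siteLift f X * siteLift g Y).trace := by
  rw [← siteLift_siteLift, ← siteLift_siteLift, ← map_mul, trace_siteLift]
  have : IsEmpty {i // i ∉ Set.range e.toEmbedding} := ⟨fun i => i.2 (by simp)⟩
  simp

open scoped Matrix.Norms.L2Operator

lemma norm_siteLift_le (f : ι ↪ κ) (X : Matrix (ι → Fin q) (ι → Fin q) ℂ) :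
    ‖siteLift f X‖ ≤ ‖X‖ :=
  NonUnitalStarAlgHom.norm_apply_le (siteLift f) X

end SiteLift

section Norms

open scoped Matrix.Norms.L2Operator

variable {n : Type} [Fintype n] [DecidableEq n]

lemma norm_star_dotProduct_mulVec_le (X : Matrix n n ℂ) (v : n → ℂ)
    (hv : star v ⬝ᵥ v = 1) : ‖star v ⬝ᵥ X.mulVec v‖ ≤ ‖X‖ := by
  have h1 : ∀ w : n → ℂ, star v ⬝ᵥ w = inner ℂ (WithLp.toLp 2 v) (WithLp.toLp 2 w) := by
    intro w
    rw [EuclideanSpace.inner_toLp_toLp, dotProduct_comm]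
  have h2 : ‖(WithLp.toLp 2 v : EuclideanSpace ℂ n)‖ = 1 := by
    have := h1 v
    rw [hv, inner_self_eq_norm_sq_to_K] at this
    have h3 : ‖(WithLp.toLp 2 v : EuclideanSpace ℂ n)‖ ^ 2 = 1 := by 
      have h4 := congrArg Complex.re this
      norm_cast at h4; exact h4.symm
    exact (pow_eq_one_iff_of_nonneg (norm_nonneg _) two_ne_zero).mp h3
  rw [h1]
  refine (norm_inner_le_norm _ _).trans ?_
  have := Matrix.l2_opNorm_mulVec X (WithLp.toLp 2 v)
  rw [h2] at this ⊢
  simpa using this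

lemma norm_trace_le (X : Matrix n n ℂ) : ‖X.trace‖ ≤ Fintype.card n * ‖X‖ := by
  refine (norm_sum_le _ _).trans ?_
  rw [← nsmul_eq_mul, ← Finset.card_univ]
  refine Finset.sum_le_card_nsmul _ _ _ fun i _ => ?_
  have := norm_star_dotProduct_mulVec_le X (Pi.single i 1) (by simp)
  simpa using this

end Norms

section Sites

variable {q k N : ℕ}

/-- The placement of a `k`-site operator at sites `l, l + 1, …, l + k - 1` (cyclically). -/
def site [NeZero N] (hkN : k ≤ N) (l : Fin N) : Fin k ↪ Fin N :=
  (Fin.castLEEmb hkN).trans (Equiv.addRight l).toEmbedding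

lemma site_apply [NeZero N] (hkN : k ≤ N) (l : Fin N) (i : Fin k) :
    site hkN l i = Fin.castLE hkN i + l := rfl

lemma site_trans_addRight [NeZero N] (hkN : k ≤ N) (l m : Fin N) :
    (site hkN l).trans (Equiv.addRight m).toEmbedding = site hkN (l + m) := by
  ext i
  simp [site_apply, add_assoc]

lemma embed_eq_siteLift [NeZero N] (hkN : k ≤ N) (a : Op q k) :
    embed q k N a = siteLift (site hkN 0) a := by
  ext x y
  simp only [embed, hkN, ↓reduceDIte, siteLift_apply, site_apply, add_zero]
  congr 2
  simp only [eq_iff_iff, Set.mem_range, site_apply, add_zero, not_exists]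
  refine forall_congr' fun i => imp_congr_left ⟨fun hi j hj => ?_, fun hi => ?_⟩
  · have := j.2
    rw [← hj] at hi
    simp at hi
    omega
  · by_contra hlt
    exact hi ⟨i, not_le.mp hlt⟩ (by ext; simp)

lemma Tmat_mul_mul_apply (Y : Op q N) (x y : Fin N → Fin q) :
    (Tmat q N * Y * (Tmat q N)ᴴ) x y =
      Y (fun i => x (finRotate N i)) (fun i => y (finRotate N i)) := by
  have h1 : ∀ x y : Fin N → Fin q,
      x = confShift q N y ↔ (fun i => x (finRotate N i)) = y := by
    intro x y
    rw [← Equiv.symm_apply_eq]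
    rfl
  simp [Matrix.mul_apply, Tmat, h1, apply_ite]

lemma Tmat_conj_siteLift [NeZero N] {ι : Type} [Fintype ι] [DecidableEq ι] (f : ι ↪ Fin N)
    (X : Matrix (ι → Fin q) (ι → Fin q) ℂ) :
    Tmat q N * siteLift f X * (Tmat q N)ᴴ =
      siteLift (f.trans (Equiv.addRight 1).toEmbedding) X := by
  ext x y
  rw [Tmat_mul_mul_apply, siteLift_apply, siteLift_apply]
  simp only [finRotate_apply, Function.Embedding.trans_apply, Equiv.coe_toEmbedding,
    Equiv.coe_addRight]
  congr 2
  simp only [eq_iff_iff, Set.mem_range, not_exists, Function.Embedding.trans_apply,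
    Equiv.coe_toEmbedding, Equiv.coe_addRight]
  rw [(Equiv.addRight (1 : Fin N)).forall_congr_left]
  simp [← sub_eq_add_neg, eq_sub_iff_add_eq]

lemma Tmat_pow_conj_siteLift [NeZero N] {ι : Type} [Fintype ι] [DecidableEq ι] (f : ι ↪ Fin N)
    (X : Matrix (ι → Fin q) (ι → Fin q) ℂ) (l : ℕ) :
    Tmat q N ^ l * siteLift f X * (Tmat q N)ᴴ ^ l =
      siteLift (f.trans (Equiv.addRight (Fin.ofNat N l)).toEmbedding) X := by
  induction l with
  | zero =>
    rw [pow_zero, pow_zero, one_mul, mul_one]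
    congr 2
    ext i
    simp
  | succ l ih =>
    rw [pow_succ', pow_succ]
    have : Tmat q N * Tmat q N ^ l * siteLift f X * ((Tmat q N)ᴴ ^ l * (Tmat q N)ᴴ) =
      Tmat q N * (Tmat q N ^ l * siteLift f X * (Tmat q N)ᴴ ^ l) * (Tmat q N)ᴴ := by
      simp only [mul_assoc]
    rw [this, ih, Tmat_conj_siteLift]
    congr 2
    ext i
    simp [add_assoc, Fin.val_add]

lemma Ham_eq_sum [NeZero N] (hkN : k ≤ N) (h : Op q k) :
    Ham q k N h = ∑ l : Fin N, siteLift (site hkN l) h := by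
  refine Finset.sum_congr rfl fun l _ => ?_
  rw [embed_eq_siteLift hkN, Tmat_pow_conj_siteLift, Fin.ofNat_val_eq_self, site_trans_addRight,
    zero_add]

lemma Ham_isHermitian [NeZero N] (hkN : k ≤ N) {h : Op q k} (hh : h.IsHermitian) :
    (Ham q k N h).IsHermitian := by
  rw [Ham_eq_sum hkN, Matrix.IsHermitian, ← Matrix.star_eq_conjTranspose, star_sum]
  refine Finset.sum_congr rfl fun l _ => ?_
  rw [← map_star, Matrix.star_eq_conjTranspose, hh.eq]

lemma trace_Ham [NeZero N] (hkN : k ≤ N) {h : Op q k} (htr : h.trace = 0) :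
    (Ham q k N h).trace = 0 := by
  rw [Ham_eq_sum hkN, Matrix.trace_sum]
  exact Finset.sum_eq_zero fun l _ => by rw [trace_siteLift, htr, zero_mul]

lemma trace_Ham_sq [NeZero q] [NeZero N] (hkN : k ≤ N) (h : Op q k) :
    (Ham q k N h ^ 2).trace = N * (Ham q k N h * embed q k N h).trace := by
  have key : ∀ l : Fin N, (Ham q k N h * siteLift (site hkN l) h).trace =
      (Ham q k N h * embed q k N h).trace := by
    intro l
    rw [embed_eq_siteLift hkN, Ham_eq_sum hkN, Finset.sum_mul, Finset.sum_mul, Matrix.trace_sum,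
      Matrix.trace_sum, ← Equiv.sum_comp (Equiv.addRight l)]
    refine Finset.sum_congr rfl fun m _ => ?_
    rw [← trace_siteLift_mul_siteLift_trans (Equiv.addRight l) (site hkN m),
      site_trans_addRight, site_trans_addRight, zero_add]
    rfl
  rw [pow_two]
  nth_rewrite 2 [Ham_eq_sum hkN]
  rw [Finset.mul_sum, Matrix.trace_sum, Finset.sum_congr rfl fun l _ => key l]
  simp

/-- The indicator that the supports of the local terms at `l` and `m` overlap. -/
def overlap [NeZero N] (hkN : k ≤ N) (l m : Fin N) : ℝ :=
  if ∃ i j, site hkN l i = site hkN m j then 1 else 0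

lemma overlap_symm [NeZero N] (hkN : k ≤ N) (l m : Fin N) :
    overlap hkN l m = overlap hkN m l := by
  unfold overlap
  congr 1
  rw [exists_comm]
  simp only [eq_comm]

lemma sum_overlap_le [NeZero N] (hkN : k ≤ N) (l : Fin N) :
    ∑ m, overlap hkN l m ≤ (k : ℝ) ^ 2 := by
  have h1 : ∀ m, overlap hkN l m ≤
      ∑ i : Fin k, ∑ j : Fin k, if m = site hkN l i - Fin.castLE hkN j then (1 : ℝ) else 0 := by
    intro m
    have hnn : ∀ i j : Fin k,
        0 ≤ (if m = site hkN l i - Fin.castLE hkN j then (1 : ℝ) else 0) := by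
      intro i j; split_ifs <;> simp
    unfold overlap
    split_ifs with hex
    · obtain ⟨i, j, hij⟩ := hex
      have hm : m = site hkN l i - Fin.castLE hkN j := by
        rw [hij, site_apply, add_sub_cancel_left]
      calc (1 : ℝ) = if m = site hkN l i - Fin.castLE hkN j then (1 : ℝ) else 0 := by
            rw [if_pos hm]
        _ ≤ ∑ j : Fin k, if m = site hkN l i - Fin.castLE hkN j then (1 : ℝ) else 0 :=
            Finset.single_le_sum (f := fun j => if m = site hkN l i - Fin.castLE hkN j
              then (1 : ℝ) else 0) (fun j _ => hnn i j) (Finset.mem_univ j)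
        _ ≤ _ := Finset.single_le_sum (f := fun i => ∑ j : Fin k,
              if m = site hkN l i - Fin.castLE hkN j then (1 : ℝ) else 0)
              (fun i _ => Finset.sum_nonneg fun j _ => hnn i j) (Finset.mem_univ i)
    · exact Finset.sum_nonneg fun i _ => Finset.sum_nonneg fun j _ => hnn i j
  refine (Finset.sum_le_sum fun m _ => h1 m).trans ?_
  rw [Finset.sum_comm]
  simp_rw [Finset.sum_comm (s := Finset.univ (α := Fin N))]
  simp [pow_two]

lemma siteLift_site_mem_awayFrom [NeZero N] (hkN : k ≤ N) {l m : Fin N} (h : Op q k)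
    (hlm : overlap hkN l m = 0) :
    siteLift (site hkN m) h ∈ awayFrom q (site hkN l) := by
  refine siteLift_mem_awayFrom _ _ (fun i j hij => ?_) h
  rw [overlap, if_pos ⟨i, j, hij⟩] at hlm
  exact one_ne_zero hlm

lemma overlap_eq_zero_or_one [NeZero N] (hkN : k ≤ N) (l m : Fin N) :
    overlap hkN l m = 0 ∨ overlap hkN l m = 1 := by
  unfold overlap; split_ifs <;> simp

end Sites

section Counting

variable {N : ℕ} {r : Fin N → Fin N → ℝ} {B : ℝ}

lemma sum_sum_mul_le (hr : ∀ l m, 0 ≤ r l m) (hB : ∀ l, ∑ m, r l m ≤ B) {G : Fin N → Fin N → ℝ}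
    {S : ℝ} (hS : 0 ≤ S) (hG : ∀ l m, G l m ≤ S) :
    ∑ l, ∑ m, r l m * G l m ≤ N * B * S := by
  have : ∀ l, ∑ m, r l m * G l m ≤ B * S := fun l =>
    calc ∑ m, r l m * G l m ≤ ∑ m, r l m * S :=
          Finset.sum_le_sum fun m _ => mul_le_mul_of_nonneg_left (hG l m) (hr l m)
      _ = (∑ m, r l m) * S := by rw [Finset.sum_mul]
      _ ≤ B * S := mul_le_mul_of_nonneg_right (hB l) hS
  refine (Finset.sum_le_sum fun l _ => this l).trans ?_
  simp [mul_assoc]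

lemma sum_three_le (hr : ∀ l m, 0 ≤ r l m) (hsymm : ∀ l m, r l m = r m l)
    (hB0 : 0 ≤ B) (hB : ∀ l, ∑ m, r l m ≤ B) :
    ∑ x, ∑ y, ∑ z, (r x y * (r z x + r z y) + r x z * (r y x + r y z)) ≤ 4 * B ^ 2 * N := by
  have base : ∑ x, ∑ y, ∑ z, r x y * (r z x + r z y) ≤ 2 * B ^ 2 * N := by
    simp_rw [← Finset.mul_sum]
    refine (sum_sum_mul_le hr hB (S := 2 * B) (by positivity) fun l m => ?_).trans
      (le_of_eq (by ring))
    rw [Finset.sum_add_distrib]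
    simp_rw [hsymm _ l, hsymm _ m]
    linarith [hB l, hB m]
  have swap : ∑ x, ∑ y, ∑ z, r x z * (r y x + r y z) =
      ∑ x, ∑ y, ∑ z, r x y * (r z x + r z y) :=
    Finset.sum_congr rfl fun x _ => Finset.sum_comm
  have split : ∀ F G : Fin N → Fin N → Fin N → ℝ, ∑ x, ∑ y, ∑ z, (F x y z + G x y z) =
      ∑ x, ∑ y, ∑ z, F x y z + ∑ x, ∑ y, ∑ z, G x y z := by
    intro F G
    simp only [Finset.sum_add_distrib]
  rw [split, swap]
  linarith

lemma sum_four_le (hr : ∀ l m, 0 ≤ r l m) (hsymm : ∀ l m, r l m = r m l)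
    (hB0 : 0 ≤ B) (hB : ∀ l, ∑ m, r l m ≤ B) :
    ∑ x, ∑ y, ∑ z, ∑ w, (r x y * (r z x + r z y + r z w) + r x z * (r y x + r y z + r y w) +
      r x w * (r y x + r y w + r y z)) ≤ 9 * B ^ 2 * N ^ 2 := by
  have base : ∑ x, ∑ y, ∑ z, ∑ w, r x y * (r z x + r z y + r z w) ≤ 3 * B ^ 2 * N ^ 2 := by
    simp_rw [← Finset.mul_sum]
    refine (sum_sum_mul_le hr hB (S := 3 * B * N) (by positivity) fun l m => ?_).trans
      (le_of_eq (by ring))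
    have h1 : ∀ l, ∑ z : Fin N, ∑ w : Fin N, r z l ≤ B * N := by
      intro l
      simp_rw [hsymm _ l]
      simp only [Finset.sum_const, Finset.card_univ, Fintype.card_fin, nsmul_eq_mul,
        ← Finset.mul_sum]
      nlinarith [hB l, Nat.cast_nonneg (α := ℝ) N]
    have h2 : ∑ z : Fin N, ∑ w : Fin N, r z w ≤ B * N := by
      refine (Finset.sum_le_sum fun z _ => hB z).trans ?_
      simp [mul_comm]
    simp_rw [Finset.sum_add_distrib]
    linarith [h1 l, h1 m]
  have e1 : ∑ x, ∑ y, ∑ z, ∑ w, r x z * (r y x + r y z + r y w) =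
      ∑ x, ∑ y, ∑ z, ∑ w, r x y * (r z x + r z y + r z w) :=
    Finset.sum_congr rfl fun x _ => Finset.sum_comm
  have e2 : ∑ x, ∑ y, ∑ z, ∑ w, r x w * (r y x + r y w + r y z) =
      ∑ x, ∑ y, ∑ z, ∑ w, r x y * (r z x + r z y + r z w) := by
    refine Finset.sum_congr rfl fun x _ => ?_
    rw [Finset.sum_comm' (s' := fun _ => Finset.univ) (t' := Finset.univ) (by simp)]
    rw [Finset.sum_congr rfl fun z _ => Finset.sum_comm, Finset.sum_comm]
    exact Finset.sum_congr rfl fun w _ => Finset.sum_comm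
  have e3 : ∀ F G K : Fin N → Fin N → Fin N → Fin N → ℝ,
      ∑ x, ∑ y, ∑ z, ∑ w, (F x y z w + G x y z w + K x y z w) =
      ∑ x, ∑ y, ∑ z, ∑ w, F x y z w + ∑ x, ∑ y, ∑ z, ∑ w, G x y z w +
        ∑ x, ∑ y, ∑ z, ∑ w, K x y z w := by
    intro F G K
    simp only [Finset.sum_add_distrib]
  rw [e3, e1, e2]
  linarith

end Counting

lemma le_of_no_isolated_three {T Q p s u : ℝ} (hp : p = 0 ∨ p = 1) (hs : s = 0 ∨ s = 1)
    (hu : u = 0 ∨ u = 1) (hT0 : 0 ≤ T) (hT : T ≤ Q) (vx : p = 0 → s = 0 → T = 0)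
    (vy : p = 0 → u = 0 → T = 0) (vz : s = 0 → u = 0 → T = 0) :
    T ≤ Q * (p * (s + u) + s * (p + u)) := by
  rcases hp with rfl | rfl <;> rcases hs with rfl | rfl <;> rcases hu with rfl | rfl <;>
  simp at vx vy vz ⊢ <;> linarith

lemma le_of_no_isolated_four {T Q p s t u v w : ℝ} (hp : p = 0 ∨ p = 1) (hs : s = 0 ∨ s = 1)
    (ht : t = 0 ∨ t = 1) (hu : u = 0 ∨ u = 1) (hv : v = 0 ∨ v = 1) (hw : w = 0 ∨ w = 1)
    (hT0 : 0 ≤ T) (hT : T ≤ Q) (vx : p = 0 → s = 0 → t = 0 → T = 0)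
    (vy : p = 0 → u = 0 → v = 0 → T = 0) (vz : s = 0 → u = 0 → w = 0 → T = 0)
    (vw : t = 0 → v = 0 → w = 0 → T = 0) :
    T ≤ Q * (p * (s + u + w) + s * (p + u + v) + t * (p + v + u)) := by
  rcases hp with rfl | rfl <;> rcases hs with rfl | rfl <;> rcases ht with rfl | rfl <;>
  rcases hu with rfl | rfl <;> rcases hv with rfl | rfl <;> rcases hw with rfl | rfl <;>
  simp at vx vy vz vw ⊢ <;> linarith

section Moments

open scoped Matrix.Norms.L2Operator

variable {N : ℕ} {n : Type} [Fintype n] [DecidableEq n] {r : Fin N → Fin N → ℝ} {B : ℝ}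
  {t : Fin N → Matrix n n ℂ}

lemma norm_trace_sum_pow_three_le (hr : ∀ l m, r l m = 0 ∨ r l m = 1)
    (hsymm : ∀ l m, r l m = r m l) (hB0 : 0 ≤ B) (hB : ∀ l, ∑ m, r l m ≤ B)
    (ht : ∀ l, ‖t l‖ ≤ 1)
    (hvan : ∀ x y z, r x y = 0 → r x z = 0 → (t x * (t y * t z)).trace = 0) :
    ‖((∑ l, t l) ^ 3).trace‖ ≤ Fintype.card n * (4 * B ^ 2 * N) := by
  have hr0 : ∀ l m, 0 ≤ r l m := fun l m => by rcases hr l m with h | h <;> simp [h]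
  have hexp : ((∑ l, t l) ^ 3).trace = ∑ x, ∑ y, ∑ z, (t x * (t y * t z)).trace := by
    rw [pow_succ', pow_two]
    simp only [Finset.sum_mul_sum]
    simp only [Finset.mul_sum, Matrix.trace_sum]
  have hterm : ∀ x y z, ‖(t x * (t y * t z)).trace‖ ≤
      Fintype.card n * (r x y * (r z x + r z y) + r x z * (r y x + r y z)) := by
    intro x y z
    have h3 : ‖t x * (t y * t z)‖ ≤ 1 * (1 * 1) :=
      norm_mul_le_of_le (ht x) (norm_mul_le_of_le (ht y) (ht z))
    rw [hsymm y x, hsymm z x, hsymm z y]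
    refine le_of_no_isolated_three (hr x y) (hr x z) (hr y z) (norm_nonneg _)
      ((norm_trace_le _).trans (mul_le_of_le_one_right (by positivity) (by simpa using h3)))
      (fun h1 h2 => ?_) (fun h1 h2 => ?_) (fun h1 h2 => ?_)
    · rw [hvan x y z h1 h2, norm_zero]
    · rw [Matrix.trace_mul_comm, mul_assoc, hvan y z x h2 (hsymm y x ▸ h1), norm_zero]
    · rw [← mul_assoc, Matrix.trace_mul_comm, hvan z x y (hsymm z x ▸ h1) (hsymm z y ▸ h2),
        norm_zero]
  rw [hexp]
  refine (norm_sum_le_of_le _ fun x _ => norm_sum_le_of_le _ fun y _ =>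
    norm_sum_le_of_le _ fun z _ => hterm x y z).trans ?_
  simp_rw [← Finset.mul_sum]
  exact mul_le_mul_of_nonneg_left (sum_three_le hr0 hsymm hB0 hB) (by positivity)

lemma norm_trace_sum_pow_four_le (hr : ∀ l m, r l m = 0 ∨ r l m = 1)
    (hsymm : ∀ l m, r l m = r m l) (hB0 : 0 ≤ B) (hB : ∀ l, ∑ m, r l m ≤ B)
    (ht : ∀ l, ‖t l‖ ≤ 1)
    (hvan : ∀ x y z w, r x y = 0 → r x z = 0 → r x w = 0 →
      (t x * (t y * (t z * t w))).trace = 0) :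
    ‖((∑ l, t l) ^ 4).trace‖ ≤ Fintype.card n * (9 * B ^ 2 * N ^ 2) := by
  have hr0 : ∀ l m, 0 ≤ r l m := fun l m => by rcases hr l m with h | h <;> simp [h]
  have hexp : ((∑ l, t l) ^ 4).trace =
      ∑ x, ∑ y, ∑ z, ∑ w, (t x * (t y * (t z * t w))).trace := by
    rw [pow_succ', pow_succ', pow_two]
    simp only [Finset.sum_mul_sum]
    simp only [Finset.mul_sum, Matrix.trace_sum]
  have hterm : ∀ x y z w, ‖(t x * (t y * (t z * t w))).trace‖ ≤
      Fintype.card n * (r x y * (r z x + r z y + r z w) + r x z * (r y x + r y z + r y w) +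
      r x w * (r y x + r y w + r y z)) := by
    intro x y z w
    have h4 : ‖t x * (t y * (t z * t w))‖ ≤ 1 * (1 * (1 * 1)) :=
      norm_mul_le_of_le (ht x) (norm_mul_le_of_le (ht y) (norm_mul_le_of_le (ht z) (ht w)))
    rw [hsymm y x, hsymm z x, hsymm z y]
    refine le_of_no_isolated_four (hr x y) (hr x z) (hr x w) (hr y z) (hr y w) (hr z w)
      (norm_nonneg _)
      ((norm_trace_le _).trans (mul_le_of_le_one_right (by positivity) (by simpa using h4)))
      (fun h1 h2 h3 => ?_) (fun h1 h2 h3 => ?_) (fun h1 h2 h3 => ?_) (fun h1 h2 h3 => ?_)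
    · rw [hvan x y z w h1 h2 h3, norm_zero]
    · rw [Matrix.trace_mul_comm, mul_assoc, mul_assoc, hvan y z w x h2 h3 (hsymm y x ▸ h1),
        norm_zero]
    · rw [← mul_assoc, Matrix.trace_mul_comm, mul_assoc,
        hvan z w x y h3 (hsymm z x ▸ h1) (hsymm z y ▸ h2), norm_zero]
    · rw [← mul_assoc, ← mul_assoc, Matrix.trace_mul_comm, mul_assoc,
        hvan w x y z (hsymm w x ▸ h1) (hsymm w y ▸ h2) (hsymm w z ▸ h3), norm_zero]
  rw [hexp]
  refine (norm_sum_le_of_le _ fun x _ => norm_sum_le_of_le _ fun y _ =>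
    norm_sum_le_of_le _ fun z _ => norm_sum_le_of_le _ fun w _ => hterm x y z w).trans ?_
  simp_rw [← Finset.mul_sum]
  exact mul_le_mul_of_nonneg_left (sum_four_le hr0 hsymm hB0 hB) (by positivity)

variable {q k : ℕ}

lemma norm_siteLift_site_le [NeZero N] (hkN : k ≤ N) {h : Op q k} (hn : opNorm h = 1)
    (l : Fin N) : ‖siteLift (site hkN l) h‖ ≤ 1 :=
  (norm_siteLift_le _ _).trans (le_of_eq hn)

lemma norm_trace_Ham_pow_three_le [NeZero N] (hkN : k ≤ N) {h : Op q k} (htr : h.trace = 0)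
    (hn : opNorm h = 1) :
    ‖(Ham q k N h ^ 3).trace‖ ≤ (q : ℝ) ^ N * (4 * k ^ 4 * N) := by
  rw [Ham_eq_sum hkN]
  refine (norm_trace_sum_pow_three_le (overlap_eq_zero_or_one hkN) (overlap_symm hkN)
    (sq_nonneg (k : ℝ)) (sum_overlap_le hkN) (norm_siteLift_site_le hkN hn)
    fun x y z h1 h2 => trace_siteLift_mul_eq_zero _ htr
      (mul_mem (siteLift_site_mem_awayFrom hkN h h1)
        (siteLift_site_mem_awayFrom hkN h h2))).trans (le_of_eq ?_)
  simp [← pow_mul]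

lemma norm_trace_Ham_pow_four_le [NeZero N] (hkN : k ≤ N) {h : Op q k} (htr : h.trace = 0)
    (hn : opNorm h = 1) :
    ‖(Ham q k N h ^ 4).trace‖ ≤ (q : ℝ) ^ N * (9 * k ^ 4 * N ^ 2) := by
  rw [Ham_eq_sum hkN]
  refine (norm_trace_sum_pow_four_le (overlap_eq_zero_or_one hkN) (overlap_symm hkN)
    (sq_nonneg (k : ℝ)) (sum_overlap_le hkN) (norm_siteLift_site_le hkN hn)
    fun x y z w h1 h2 h3 => trace_siteLift_mul_eq_zero _ htr
      (mul_mem (siteLift_site_mem_awayFrom hkN h h1)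
        (mul_mem (siteLift_site_mem_awayFrom hkN h h2)
          (siteLift_site_mem_awayFrom hkN h h3)))).trans (le_of_eq ?_)
  simp [← pow_mul]

end Moments

section Stability

variable {q k N : ℕ}

lemma site_ofNat_val [NeZero N] (hkN : k ≤ N) {l : ℕ} (hl : l + k ≤ N) (i : Fin k) :
    (site hkN (Fin.ofNat N l) i : ℕ) = i + l := by
  have := i.2
  rw [site_apply, Fin.val_add, Fin.val_ofNat, Fin.val_castLE, Nat.add_mod_mod,
    Nat.mod_eq_of_lt (by omega)]

/-- The normalized correlation of the local terms at sites `l` and `0`. -/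
def localCorr [NeZero N] (hkN : k ≤ N) (h : Op q k) (l : ℕ) : ℂ :=
  ntr (siteLift (site hkN (Fin.ofNat N l)) h * siteLift (site hkN (Fin.ofNat N 0)) h)

lemma localCorr_eq_of_le [NeZero q] {N' : ℕ} [NeZero N] [NeZero N'] (hkN : k ≤ N) (hN : N ≤ N')
    (h : Op q k) {l : ℕ} (hl : l + k ≤ N) :
    localCorr (hkN.trans hN) h l = localCorr hkN h l := by
  have key : ∀ m, m + k ≤ N → site (hkN.trans hN) (Fin.ofNat N' m) =
      (site hkN (Fin.ofNat N m)).trans (Fin.castLEEmb hN) := by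
    intro m hm
    ext i
    rw [site_ofNat_val _ (hm.trans hN)]
    exact (site_ofNat_val hkN hm i).symm
  rw [localCorr, key l hl, key 0 (by omega), ← siteLift_siteLift, ← siteLift_siteLift,
    ← map_mul, ntr_siteLift, localCorr]

lemma localCorr_eq_zero [NeZero N] (hkN : k ≤ N) {h : Op q k} (htr : h.trace = 0) {l : ℕ}
    (hkl : k ≤ l) (hl : l + k ≤ N) : localCorr hkN h l = 0 := by
  rw [localCorr, ntr, trace_siteLift_mul_eq_zero _ htr, zero_div]
  refine siteLift_mem_awayFrom _ _ (fun i j hij => ?_) h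
  have := congrArg Fin.val hij
  rw [site_ofNat_val hkN hl, site_ofNat_val hkN (by omega)] at this
  omega

lemma localCorr_sub [NeZero q] [NeZero N] (hkN : k ≤ N) (h : Op q k) {l : ℕ} (hl : l ≤ N) :
    localCorr hkN h (N - l) = localCorr hkN h l := by
  have h1 : Fin.ofNat N (N - l) + Fin.ofNat N l = Fin.ofNat N 0 := by
    ext
    simp [Fin.val_add, Nat.sub_add_cancel hl]
  rw [localCorr, ntr, ← trace_siteLift_mul_siteLift_trans (Equiv.addRight (Fin.ofNat N l)),
    site_trans_addRight, site_trans_addRight, h1, Matrix.trace_mul_comm, localCorr, ntr]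
  simp

lemma ntr_Ham_mul_embed [NeZero q] [NeZero N] (hkN : 2 * k ≤ N) {h : Op q k}
    (htr : h.trace = 0) :
    ntr (Ham q k N h * embed q k N h) =
      ∑ l ∈ Finset.range k, localCorr (by omega : k ≤ N) h l +
        ∑ l ∈ Finset.range k, localCorr (by omega : k ≤ N) h (l + 1) := by
  have hk : k ≤ N := by omega
  have h1 : ntr (Ham q k N h * embed q k N h) = ∑ l ∈ Finset.range N, localCorr hk h l := by
    rw [← Fin.sum_univ_eq_sum_range, Ham_eq_sum hk, embed_eq_siteLift hk, Finset.sum_mul, ntr,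
      Matrix.trace_sum, Finset.sum_div]
    refine Finset.sum_congr rfl fun l _ => ?_
    rw [localCorr, ntr, Fin.ofNat_val_eq_self]
    simp
  have h2 : ∑ l ∈ Finset.range (N - k), localCorr hk h (k + l) =
      ∑ l ∈ Finset.range k, localCorr hk h (l + 1) := by
    rw [← Finset.sum_range_reflect]
    symm
    refine Finset.sum_subset_zero_on_sdiff (fun l hl => ?_) (fun l hl => ?_) (fun l hl => ?_)
    · simp only [Finset.mem_range] at *; omega
    · simp only [Finset.mem_range, Finset.mem_sdiff] at hl
      rw [show k + (N - k - 1 - l) = N - (l + 1) by omega, localCorr_sub hk h (by omega)]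
      exact localCorr_eq_zero hk htr (by omega) (by omega)
    · simp only [Finset.mem_range] at hl
      rw [show k + (N - k - 1 - l) = N - (l + 1) by omega, localCorr_sub hk h (by omega)]
  rw [h1, ← h2, ← Finset.sum_range_add, Nat.add_sub_cancel' hk]

lemma ntr_Ham_mul_embed_eq [NeZero q] {N' : ℕ} [NeZero N] [NeZero N'] (hkN : 2 * k ≤ N)
    (hN : N ≤ N') {h : Op q k} (htr : h.trace = 0) :
    ntr (Ham q k N' h * embed q k N' h) = ntr (Ham q k N h * embed q k N h) := by
  rw [ntr_Ham_mul_embed hkN htr, ntr_Ham_mul_embed (hkN.trans hN) htr]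
  congr 1 <;> refine Finset.sum_congr rfl fun l hl => ?_ <;> rw [Finset.mem_range] at hl <;>
  exact localCorr_eq_of_le _ hN h (by omega)

end Stability

section Spectral

variable {q N : ℕ} {H : Op q N}

lemma trace_eq_sum_eev (D : EigData q N H) (X : Op q N) : X.trace = ∑ j, eev D X j := by
  set V : Op q N := Matrix.of fun x j => D.v j x with hV
  have h1 : Vᴴ * V = 1 := by
    ext i j
    rw [Matrix.one_apply, ← D.orth i j]
    rfl
  have h2 : V * Vᴴ = 1 := mul_eq_one_comm.mp h1
  calc X.trace = (Vᴴ * (X * V)).trace := by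
        rw [Matrix.trace_mul_comm, mul_assoc, h2, mul_one]
    _ = _ := rfl

lemma eev_mul_pow (D : EigData q N H) (X : Op q N) (p : ℕ) (j : Fin N → Fin q) :
    eev D (X * H ^ p) j = (D.E j : ℂ) ^ p * eev D X j := by
  have hp : (H ^ p).mulVec (D.v j) = ((D.E j : ℂ) ^ p) • D.v j := by
    induction p with
    | zero => simp
    | succ p ih =>
      rw [pow_succ', ← Matrix.mulVec_mulVec, ih, Matrix.mulVec_smul, D.eigH, smul_smul, pow_succ]
  rw [eev, ← Matrix.mulVec_mulVec, hp, Matrix.mulVec_smul, dotProduct_smul, smul_eq_mul, eev]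

lemma trace_pow_eq_sum (D : EigData q N H) (p : ℕ) :
    (H ^ p).trace = ((∑ j, D.E j ^ p : ℝ) : ℂ) := by
  rw [trace_eq_sum_eev D]
  push_cast
  refine Finset.sum_congr rfl fun j _ => ?_
  rw [← one_mul (H ^ p), eev_mul_pow, eev, Matrix.one_mulVec, D.orth]
  simp

lemma trace_mul_eq_sum (D : EigData q N H) (X : Op q N) :
    (H * X).trace = ∑ j, (D.E j : ℂ) * eev D X j := by
  rw [Matrix.trace_mul_comm, trace_eq_sum_eev D]
  refine Finset.sum_congr rfl fun j _ => ?_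
  simpa using eev_mul_pow D X 1 j

lemma norm_eev_le (D : EigData q N H) (X : Op q N) (j : Fin N → Fin q) :
    ‖eev D X j‖ ≤ opNorm X :=
  norm_star_dotProduct_mulVec_le X (D.v j) (by simpa using D.orth j j)

lemma opNorm_embed_le {m : ℕ} [NeZero N] (hm : m ≤ N) (A : Op q m) :
    opNorm (embed q m N A) ≤ opNorm A := by
  rw [embed_eq_siteLift hm]
  exact norm_siteLift_le _ A

/-- A local Taylor approximation of a bounded quantity extends globally, at the cost of a
larger cubic error. -/
lemma norm_sub_taylor_le {ε M δ x : ℝ} (hε : ε ∈ Set.Ioo (0 : ℝ) 1) (hM : 0 ≤ M) (hδ : 0 ≤ δ)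
    {z a b c gx : ℂ} (hz : ‖z‖ ≤ 1) (ha : ‖a‖ ≤ M) (hb : ‖b‖ ≤ M) (hc : ‖c‖ ≤ M)
    (hg : |x| ≤ ε → ‖gx - a - b * x - c / 2 * x ^ 2‖ ≤ M * |x| ^ 3)
    (hzg : |x| ≤ ε → ‖z - gx‖ ≤ δ) :
    ‖z - a - b * x - c / 2 * x ^ 2‖ ≤ (M + (1 + 3 * M) / ε ^ 3) * |x| ^ 3 + δ := by
  obtain ⟨hε0, hε1⟩ := hε
  rcases le_or_gt |x| ε with hx | hx
  · have h1 : z - a - b * x - c / 2 * x ^ 2 =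
        (gx - a - b * x - c / 2 * x ^ 2) + (z - gx) := by ring
    rw [h1]
    have h2 : 0 ≤ (1 + 3 * M) / ε ^ 3 * |x| ^ 3 := by positivity
    linarith [norm_add_le (gx - a - b * x - c / 2 * x ^ 2) (z - gx), hg hx, hzg hx]
  · set y := |x| / ε with hy
    have hy1 : 1 ≤ y := (one_le_div hε0).mpr hx.le
    have hxy : |x| ≤ y := le_div_self (abs_nonneg x) hε0 hε1.le
    have hb' : ‖b * x‖ ≤ M * y := by
      rw [norm_mul, Complex.norm_real, Real.norm_eq_abs]
      exact mul_le_mul hb hxy (abs_nonneg x) hM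
    have hc' : ‖c / 2 * (x : ℂ) ^ 2‖ ≤ M * y ^ 2 := by
      rw [norm_mul, norm_pow, Complex.norm_real, Real.norm_eq_abs, norm_div, Complex.norm_ofNat]
      exact mul_le_mul (by linarith [norm_nonneg c])
        (pow_le_pow_left₀ (abs_nonneg x) hxy 2) (by positivity) hM
    have h1 : ‖z - a - b * x - c / 2 * x ^ 2‖ ≤ 1 + M + M * y + M * y ^ 2 := by
      linarith [norm_sub_le (z - a - b * x) (c / 2 * x ^ 2), norm_sub_le (z - a) (b * x),
        norm_sub_le z a]
    have h3 : (1 + 3 * M) / ε ^ 3 * |x| ^ 3 = (1 + 3 * M) * y ^ 3 := by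
      rw [hy, div_pow]; ring
    have hy2 : y ^ 2 ≤ y ^ 3 := pow_le_pow_right₀ hy1 (by norm_num)
    have hy3 : y ≤ y ^ 3 := le_self_pow₀ hy1 (by norm_num)
    have h4 : 0 ≤ M * |x| ^ 3 := by positivity
    rw [add_mul, h3]
    nlinarith

end Spectral

section Main

variable {q k N : ℕ}

/-- Comparing `tr (H A)` with its Taylor prediction `b * tr (H h)`, via the moments of `H`. -/
lemma norm_trace_sub_le [NeZero q] [NeZero N] (hkN : k ≤ N) {h : Op q k} (htr : h.trace = 0)
    (hn : opNorm h = 1) (D : EigData q N (Ham q k N h)) {B : Op q N} {a b c : ℂ} {C K M : ℝ}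
    (hC : 0 ≤ C) (hK : 0 ≤ K) (hc : ‖c‖ ≤ M)
    (herr : ∀ j, ‖eev D B j - a - b * (D.E j / N : ℝ) - c / 2 * ((D.E j / N : ℝ) : ℂ) ^ 2‖ ≤
      C * |D.E j / N| ^ 3 + K / (N : ℝ) ^ 2) :
    ‖b * (Ham q k N h * embed q k N h).trace - (Ham q k N h * B).trace‖ ≤
      (q : ℝ) ^ N * (9 * k ^ 4 * C + K * (1 + ‖ntr (Ham q k N h * embed q k N h)‖) +
        2 * k ^ 4 * M) / N := by
  have hN : (0 : ℝ) < N := Nat.cast_pos.mpr (NeZero.pos N)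
  have hNc : (N : ℂ) ≠ 0 := Nat.cast_ne_zero.mpr (NeZero.ne N)
  have hd : (0 : ℝ) < (q : ℝ) ^ N := pow_pos (Nat.cast_pos.mpr (NeZero.pos q)) N
  set τ := ‖ntr (Ham q k N h * embed q k N h)‖ with hτ
  have hcorr : ‖(Ham q k N h * embed q k N h).trace‖ = (q : ℝ) ^ N * τ := by
    rw [hτ, ntr, norm_div]
    simp [mul_div_cancel₀, hd.ne']
  have t1 : ((∑ j, D.E j : ℝ) : ℂ) = 0 := by
    have := trace_pow_eq_sum D 1
    simp only [pow_one] at this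
    rw [← this, trace_Ham hkN htr]
  have t2 : ((∑ j, D.E j ^ 2 : ℝ) : ℂ) = N * (Ham q k N h * embed q k N h).trace := by
    rw [← trace_pow_eq_sum D 2, trace_Ham_sq hkN]
  have t3 : ‖((∑ j, D.E j ^ 3 : ℝ) : ℂ)‖ ≤ (q : ℝ) ^ N * (4 * k ^ 4 * N) := by
    rw [← trace_pow_eq_sum D 3]
    exact norm_trace_Ham_pow_three_le hkN htr hn
  have t4 : ∑ j, D.E j ^ 4 ≤ (q : ℝ) ^ N * (9 * k ^ 4 * N ^ 2) := by
    have := norm_trace_Ham_pow_four_le hkN htr hn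
    rw [trace_pow_eq_sum D 4, Complex.norm_real] at this
    exact (le_abs_self _).trans this
  have t2' : ∑ j, D.E j ^ 2 = N * ((q : ℝ) ^ N * τ) := by
    have := congrArg norm t2
    rw [Complex.norm_real, norm_mul, Complex.norm_natCast, hcorr, Real.norm_eq_abs,
      abs_of_nonneg (Finset.sum_nonneg fun j _ => sq_nonneg _)] at this
    exact this
  have tabs : ∑ j, |D.E j| ≤ (q : ℝ) ^ N * (1 + τ) * N := by
    have h1 : ∑ j, |D.E j| ≤ ∑ j, (1 + D.E j ^ 2) := Finset.sum_le_sum fun j _ => by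
      rw [← sq_abs]; nlinarith [sq_nonneg (|D.E j| - 1)]
    have h2 : ∑ j, (1 + D.E j ^ 2) = (q : ℝ) ^ N + N * ((q : ℝ) ^ N * τ) := by
      rw [Finset.sum_add_distrib, t2']
      simp
    have h3 : (1 : ℝ) ≤ N := Nat.one_le_cast.mpr (NeZero.pos N)
    nlinarith
  set R : ℂ := ∑ j, (D.E j : ℂ) *
    (eev D B j - a - b * (D.E j / N : ℝ) - c / 2 * ((D.E j / N : ℝ) : ℂ) ^ 2) with hR
  have hsplit : (Ham q k N h * B).trace =
      a * ((∑ j, D.E j : ℝ) : ℂ) + b / N * ((∑ j, D.E j ^ 2 : ℝ) : ℂ) +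
      c / 2 / N ^ 2 * ((∑ j, D.E j ^ 3 : ℝ) : ℂ) + R := by
    rw [trace_mul_eq_sum D, hR]
    push_cast
    simp only [Finset.mul_sum, ← Finset.sum_add_distrib]
    refine Finset.sum_congr rfl fun j _ => ?_
    field_simp
    ring
  have hRle : ‖R‖ ≤ (q : ℝ) ^ N * (9 * k ^ 4 * C + K * (1 + τ)) / N := by
    have h1 : ‖R‖ ≤ ∑ j, (C / N ^ 3 * D.E j ^ 4 + K / N ^ 2 * |D.E j|) := by
      refine norm_sum_le_of_le _ fun j _ => ?_
      rw [norm_mul, Complex.norm_real, Real.norm_eq_abs]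
      refine (mul_le_mul_of_nonneg_left (herr j) (abs_nonneg _)).trans (le_of_eq ?_)
      have : D.E j ^ 4 = |D.E j| ^ 4 := by rw [← abs_pow, abs_of_nonneg (by positivity)]
      rw [this, abs_div, Nat.abs_cast]
      ring
    rw [Finset.sum_add_distrib, ← Finset.mul_sum, ← Finset.mul_sum] at h1
    refine h1.trans ((add_le_add (mul_le_mul_of_nonneg_left t4 (by positivity))
      (mul_le_mul_of_nonneg_left tabs (by positivity))).trans (le_of_eq ?_))
    field_simp
  have hdiff : b * (Ham q k N h * embed q k N h).trace - (Ham q k N h * B).trace =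
      -(c / 2 / N ^ 2 * ((∑ j, D.E j ^ 3 : ℝ) : ℂ)) - R := by
    rw [hsplit, t1, t2]
    field_simp
    ring
  rw [hdiff]
  have hcub : ‖-(c / 2 / N ^ 2 * ((∑ j, D.E j ^ 3 : ℝ) : ℂ))‖ ≤
      (q : ℝ) ^ N * (2 * k ^ 4 * M) / N := by
    rw [norm_neg, norm_mul, norm_div, norm_div, norm_pow, Complex.norm_natCast,
      Complex.norm_ofNat]
    have hM : 0 ≤ M := (norm_nonneg c).trans hc
    calc ‖c‖ / 2 / (N : ℝ) ^ 2 * ‖((∑ j, D.E j ^ 3 : ℝ) : ℂ)‖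
        ≤ M / 2 / (N : ℝ) ^ 2 * ((q : ℝ) ^ N * (4 * k ^ 4 * N)) := by gcongr
      _ = _ := by field_simp; ring
  refine (norm_sub_le _ _).trans ((add_le_add hcub hRle).trans (le_of_eq ?_))
  ring

open scoped ComplexOrder in
lemma ntr_Ham_mul_embed_ne_zero [NeZero q] [NeZero N] (hkN : k ≤ N) {h : Op q k}
    (hh : h.IsHermitian) (hne : Ham q k N h ≠ 0) :
    ntr (Ham q k N h * embed q k N h) ≠ 0 := by
  intro h0
  have hcard : (Fintype.card (Fin N → Fin q) : ℂ) ≠ 0 := Nat.cast_ne_zero.mpr Fintype.card_ne_zero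
  rw [ntr, div_eq_zero_iff, or_iff_left hcard] at h0
  have h1 := trace_Ham_sq hkN h
  rw [h0, mul_zero, pow_two] at h1
  nth_rewrite 1 [← (Ham_isHermitian hkN hh).eq] at h1
  exact hne (Matrix.trace_conjTranspose_mul_self_eq_zero_iff.mp h1)

end Main

end

/-- Under the ETH ansatz, `g_N'(0) = b_N = tr(H_N A)/tr(H_N h) + O(1/N)`. -/
theorem eth_g_deriv (dloc k k' : ℕ) (hdloc : 2 ≤ dloc) (hk : 1 ≤ k)
    (h : Op dloc k) (hherm : h.IsHermitian) (htr : h.trace = 0) (hnorm : opNorm h = 1)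
    (D : ∀ N, EigData dloc N (Ham dloc k N h))
    (hH : ∀ N₀ : ℕ, ∃ N : ℕ, N₀ ≤ N ∧ Ham dloc k N h ≠ 0)
    (A : Op dloc k') (hAtr : A.trace = 0) (hAnorm : opNorm A = 1)
    (ε M K : ℝ) (hε : ε ∈ Set.Ioo (0 : ℝ) 1) (hM : 0 ≤ M) (hK : 0 ≤ K)
    (g : ℕ → ℝ → ℂ) (a b c : ℕ → ℂ)
    (hgbd : ∀ N : ℕ, ∀ x ∈ Set.Icc (-ε) ε, ‖g N x‖ ≤ 1)
    (habc : ∀ N : ℕ, ‖a N‖ ≤ M ∧ ‖b N‖ ≤ M ∧ ‖c N‖ ≤ M)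
    (htaylor : ∀ N : ℕ, ∀ x ∈ Set.Icc (-ε) ε,
      ‖g N x - a N - b N * x - c N / 2 * x ^ 2‖ ≤ M * |x| ^ 3)
    (heth : ∀ N : ℕ, ∀ j, |(D N).E j| ≤ N * ε →
      ‖eev (D N) (embed dloc k' N A) j - g N ((D N).E j / N)‖ ≤ K / (N : ℝ) ^ 2) :
    ∃ C : ℝ, ∃ N₀ : ℕ, ∀ N : ℕ, N₀ ≤ N →
      ‖b N - (Ham dloc k N h * embed dloc k' N A).trace /
          (Ham dloc k N h * embed dloc k N h).trace‖ ≤ C / N := by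
  have : NeZero dloc := ⟨by omega⟩
  have : NeZero (2 * k) := ⟨by omega⟩
  set τ : ℂ := ntr (Ham dloc k (2 * k) h * embed dloc k (2 * k) h) with hτ
  have hτN : ∀ N, 2 * k ≤ N → ntr (Ham dloc k N h * embed dloc k N h) = τ := by
    intro N hN
    have : NeZero N := ⟨by omega⟩
    exact ntr_Ham_mul_embed_eq le_rfl hN htr
  have hτ0 : τ ≠ 0 := by
    obtain ⟨N, hN, hne⟩ := hH (2 * k)
    have : NeZero N := ⟨by omega⟩
    rw [← hτN N hN]
    exact ntr_Ham_mul_embed_ne_zero (by omega) hherm hne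
  set C₁ : ℝ := M + (1 + 3 * M) / ε ^ 3 with hC₁
  have hε0 : 0 < ε := hε.1
  have hC₁0 : 0 ≤ C₁ := by positivity
  refine ⟨(9 * k ^ 4 * C₁ + K * (1 + ‖τ‖) + 2 * k ^ 4 * M) / ‖τ‖, max (2 * k) k', fun N hN => ?_⟩
  have hN2 : 2 * k ≤ N := (le_max_left _ _).trans hN
  have hNk' : k' ≤ N := (le_max_right _ _).trans hN
  have : NeZero N := ⟨by omega⟩
  have hN0 : (0 : ℝ) < N := Nat.cast_pos.mpr (NeZero.pos N)
  have hd : (0 : ℝ) < (dloc : ℝ) ^ N := pow_pos (Nat.cast_pos.mpr (NeZero.pos dloc)) N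
  have hmain := norm_trace_sub_le (by omega : k ≤ N) htr hnorm (D N)
    (B := embed dloc k' N A) (a := a N) (b := b N) hC₁0 hK (habc N).2.2 fun j =>
      norm_sub_taylor_le hε hM (by positivity)
        ((norm_eev_le (D N) _ j).trans ((opNorm_embed_le hNk' A).trans hAnorm.le))
        (habc N).1 (habc N).2.1 (habc N).2.2
        (fun hx => htaylor N _ (abs_le.mp hx))
        (fun hx => heth N j (by
          rw [abs_div, Nat.abs_cast, div_le_iff₀ hN0] at hx
          linarith))
  rw [hτN N hN2] at hmain
  have hnorm_trace : ‖(Ham dloc k N h * embed dloc k N h).trace‖ = (dloc : ℝ) ^ N * ‖τ‖ := by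
    rw [← hτN N hN2, ntr, norm_div]
    simp [mul_div_cancel₀, hd.ne']
  have hτpos : 0 < ‖τ‖ := norm_pos_iff.mpr hτ0
  have hne : (Ham dloc k N h * embed dloc k N h).trace ≠ 0 := by
    rw [← norm_pos_iff, hnorm_trace]
    positivity
  rw [← mul_div_cancel_right₀ (b N) hne, ← sub_div, norm_div, hnorm_trace,
    div_le_iff₀ (by positivity)]
  refine hmain.trans (le_of_eq ?_)
  field_simp
end

section
/- There is a constant C, depending only on d_loc and k', such that for every N ≥ k' and every traceless operator A on the first k' sites with ‖A‖ ≤ 1, the translation average 𝔸 = (1/N) Σ_{l=0}^{N−1} T^l A T^{−l} satisfies tr(𝔸†𝔸)/d ≤ C/N. -/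
open Matrix MeasureTheory Filter

/-- The operator `a` acting on the sites `e j`, tensored with the identity on the sites outside
the range of `e`. -/
noncomputable def siteEmbed {ι κ S : Type*} (e : κ → ι) (a : Matrix (κ → S) (κ → S) ℂ) :
    Matrix (ι → S) (ι → S) ℂ :=
  open scoped Classical in
  fun x y => if ∀ i ∉ Set.range e, x i = y i then a (x ∘ e) (y ∘ e) else 0

/-- A sum over configurations factorizes over complementary sets of sites. -/
lemma sum_comp_mul_restrict {ι κ S R : Type*} [Fintype ι] [Fintype κ] [DecidableEq ι]
    [DecidableEq κ] [Fintype S] [CommSemiring R] {e : κ → ι} (he : Function.Injective e)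
    [Fintype ↥(Set.range e)ᶜ] (f : (κ → S) → R) (g : (↥(Set.range e)ᶜ → S) → R) :
    ∑ x : ι → S, f (x ∘ e) * g (fun i => x i) = (∑ u, f u) * ∑ v, g v := by
  classical
  let s : κ ⊕ ↥(Set.range e)ᶜ ≃ ι :=
    ((Equiv.ofInjective e he).sumCongr (Equiv.refl _)).trans (Equiv.Set.sumCompl (Set.range e))
  let E : (ι → S) ≃ (κ → S) × (↥(Set.range e)ᶜ → S) :=
    (Equiv.arrowCongr s.symm (Equiv.refl S)).trans (Equiv.sumArrowEquivProdArrow _ _ _)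
  rw [Finset.sum_mul_sum, ← Fintype.sum_prod_type']
  exact Fintype.sum_equiv E _ (fun p => f p.1 * g p.2) fun x => rfl

/-- Traceless operators on disjoint sets of sites are orthogonal for the trace inner product. -/
lemma trace_conjTranspose_siteEmbed_mul_eq_zero {ι κ S : Type*} [Fintype ι] [DecidableEq ι]
    [Fintype κ] [DecidableEq κ] [Fintype S] {e e' : κ → ι} (he : Function.Injective e)
    (hdisj : ∀ i j, e i ≠ e' j) {a : Matrix (κ → S) (κ → S) ℂ} (ha : a.trace = 0)
    (b : Matrix (κ → S) (κ → S) ℂ) :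
    ((siteEmbed e a)ᴴ * siteEmbed e' b).trace = 0 := by
  classical
  have hdiag : ∀ x y : ι → S, star (siteEmbed e a y x) * siteEmbed e' b y x =
      if y = x then star (a (x ∘ e) (x ∘ e)) * b (x ∘ e') (x ∘ e') else 0 := by
    intro x y
    by_cases hxy : y = x
    · subst hxy
      simp [siteEmbed]
    · rw [if_neg hxy]
      obtain ⟨i, hi⟩ := Function.ne_iff.mp hxy
      by_cases hie : i ∈ Set.range e
      · have hie' : i ∉ Set.range e' := by
          rintro ⟨j, rfl⟩
          obtain ⟨k, hk⟩ := hie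
          exact hdisj k j hk
        have hb : siteEmbed e' b y x = 0 := if_neg fun h => hi (h i hie')
        rw [hb, mul_zero]
      · have ha0 : siteEmbed e a y x = 0 := if_neg fun h => hi (h i hie)
        rw [ha0, star_zero, zero_mul]
  have hmem : ∀ j, e' j ∈ (Set.range e)ᶜ := by
    rintro j ⟨i, hi⟩
    exact hdisj i j hi
  calc ((siteEmbed e a)ᴴ * siteEmbed e' b).trace
      = ∑ x, star (a (x ∘ e) (x ∘ e)) * b (x ∘ e') (x ∘ e') := by
        simp only [Matrix.trace, Matrix.diag_apply, Matrix.mul_apply, Matrix.conjTranspose_apply,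
          hdiag, Finset.sum_ite_eq', Finset.mem_univ, if_true]
    _ = (∑ u, star (a u u)) * ∑ v : ↥(Set.range e)ᶜ → S,
          b (fun j => v ⟨e' j, hmem j⟩) (fun j => v ⟨e' j, hmem j⟩) :=
        sum_comp_mul_restrict he (fun u => star (a u u))
          (fun v => b (fun j => v ⟨e' j, hmem j⟩) (fun j => v ⟨e' j, hmem j⟩))
    _ = 0 := by
        have h0 : ∑ u, star (a u u) = 0 := by
          rw [← star_sum]
          exact (congrArg star ha).trans (star_zero ℂ)
        rw [h0, zero_mul]

/-- The trace inner product of two local operators with entries bounded by `1` is at most the total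
dimension times the local dimension. -/
lemma norm_trace_conjTranspose_siteEmbed_mul_le {ι κ S : Type*} [Fintype ι] [DecidableEq ι]
    [Fintype κ] [DecidableEq κ] [Fintype S] (e e' : κ → ι)
    {a b : Matrix (κ → S) (κ → S) ℂ} (ha : ∀ u v, ‖a u v‖ ≤ 1) (hb : ∀ u v, ‖b u v‖ ≤ 1) :
    ‖((siteEmbed e a)ᴴ * siteEmbed e' b).trace‖ ≤
      (Fintype.card (ι → S) : ℝ) * Fintype.card (κ → S) := by
  classical
  have hterm : ∀ x y : ι → S, ‖star (siteEmbed e a y x) * siteEmbed e' b y x‖ ≤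
      if ∀ i ∉ Set.range e, y i = x i then 1 else 0 := by
    intro x y
    by_cases h : ∀ i ∉ Set.range e, y i = x i
    · have h1 : ‖siteEmbed e a y x‖ ≤ 1 := by
        simpa only [siteEmbed, if_pos h] using ha _ _
      have h2 : ‖siteEmbed e' b y x‖ ≤ 1 := by
        unfold siteEmbed
        split_ifs
        · exact hb _ _
        · simp
      rw [if_pos h, norm_mul, norm_star]
      exact mul_le_one₀ h1 (norm_nonneg _) h2
    · have h1 : siteEmbed e a y x = 0 := if_neg h
      rw [if_neg h, h1, star_zero, zero_mul, norm_zero]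
  have hcard : ∀ x : ι → S,
      (Finset.univ.filter fun y : ι → S => ∀ i ∉ Set.range e, y i = x i).card ≤
        Fintype.card (κ → S) := by
    intro x
    refine Finset.card_le_card_of_injOn (fun y => y ∘ e) (fun _ _ => Finset.mem_univ _) ?_
    intro y hy z hz hyz
    simp only [Finset.coe_filter, Finset.mem_univ, true_and, Set.mem_ofPred_eq] at hy hz
    funext i
    by_cases hi : i ∈ Set.range e
    · obtain ⟨j, rfl⟩ := hi
      exact congrFun hyz j
    · rw [hy i hi, hz i hi]
  calc ‖((siteEmbed e a)ᴴ * siteEmbed e' b).trace‖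
      ≤ ∑ x : ι → S, ∑ y : ι → S, ‖star (siteEmbed e a y x) * siteEmbed e' b y x‖ := by
        refine (norm_sum_le _ _).trans (Finset.sum_le_sum fun x _ => ?_)
        exact norm_sum_le _ _
    _ ≤ ∑ x : ι → S, (Fintype.card (κ → S) : ℝ) := by
        refine Finset.sum_le_sum fun x _ => (Finset.sum_le_sum fun y _ => hterm x y).trans ?_
        rw [Finset.sum_boole]
        exact_mod_cast hcard x
    _ = _ := by simp

/-- The entries of a matrix are bounded by its operator norm. -/
lemma norm_apply_le_opNorm {n : Type*} [Fintype n] [DecidableEq n] (A : Matrix n n ℂ) (i j : n) :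
    ‖A i j‖ ≤ opNorm A := by
  have h := (Matrix.toEuclideanCLM (𝕜 := ℂ) (n := n) A).le_opNorm (EuclideanSpace.single j 1)
  rw [PiLp.norm_single, norm_one, mul_one] at h
  refine le_trans ?_ h
  have h' := PiLp.norm_apply_le
    (Matrix.toEuclideanCLM (𝕜 := ℂ) (n := n) A (EuclideanSpace.single j 1)) i
  simpa [Matrix.ofLp_toEuclideanCLM] using h'

lemma Tmat_conj (dloc N : ℕ) (M : Op dloc N) :
    Tmat dloc N * M * (Tmat dloc N)ᴴ =
      M.submatrix (fun x => x ∘ finRotate N) (fun x => x ∘ finRotate N) := by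
  have hshift : ∀ x y : Fin N → Fin dloc,
      x = confShift dloc N y ↔ y = x ∘ finRotate N := fun x y => by
    rw [eq_comm (a := y)]
    exact (Equiv.symm_apply_eq (confShift dloc N)).symm
  ext x y
  simp [Matrix.mul_apply, Tmat, hshift, Matrix.conjTranspose_apply, apply_ite]

lemma Tmat_pow_conj (dloc N l : ℕ) (M : Op dloc N) :
    Tmat dloc N ^ l * M * (Tmat dloc N)ᴴ ^ l =
      M.submatrix (fun x => x ∘ (finRotate N ^ l : Equiv.Perm (Fin N)))
        (fun x => x ∘ (finRotate N ^ l : Equiv.Perm (Fin N))) := by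
  induction l with
  | zero => ext x y; simp
  | succ l ih =>
    rw [pow_succ' (Tmat dloc N), pow_succ (Tmat dloc N)ᴴ]
    calc _ = Tmat dloc N * (Tmat dloc N ^ l * M * (Tmat dloc N)ᴴ ^ l) * (Tmat dloc N)ᴴ := by
          simp only [mul_assoc]
      _ = _ := by
          rw [ih, Tmat_conj, pow_succ']
          rfl

/-- The position of site `j` of the first `m` sites after `l` translations. -/
def shiftedSite {m N : ℕ} (hm : m ≤ N) (l : ℕ) (j : Fin m) : Fin N :=
  (finRotate N ^ l : Equiv.Perm (Fin N)) (Fin.castLE hm j)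

lemma shiftedSite_injective {m N : ℕ} (hm : m ≤ N) (l : ℕ) :
    Function.Injective (shiftedSite hm l) :=
  (finRotate N ^ l : Equiv.Perm (Fin N)).injective.comp (Fin.castLE_injective hm)

lemma val_finRotate_pow_apply (N l : ℕ) (i : Fin N) :
    ((finRotate N ^ l : Equiv.Perm (Fin N)) i : ℕ) = (i + l) % N := by
  have : NeZero N := ⟨i.pos.ne'⟩
  induction l with
  | zero => simp [Nat.mod_eq_of_lt i.isLt]
  | succ l ih =>
    rw [pow_succ', Equiv.Perm.mul_apply, finRotate_apply, Fin.val_add, ih, Fin.val_one',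
      ← Nat.add_mod, add_assoc]

lemma shiftedSite_left_injective {m N : ℕ} (hm : m ≤ N) (j : Fin m) :
    Function.Injective fun l : Fin N => shiftedSite hm l j := by
  intro l l' h
  have hval := congrArg Fin.val h
  simp only [shiftedSite, val_finRotate_pow_apply] at hval
  exact Fin.ext ((Nat.ModEq.add_left_cancel' _ hval).eq_of_lt_of_lt l.isLt l'.isLt)

lemma embed_apply {dloc m N : ℕ} (hm : m ≤ N) (a : Op dloc m) (x y : Fin N → Fin dloc) :
    embed dloc m N a x y = a (x ∘ Fin.castLE hm) (y ∘ Fin.castLE hm) *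
      if ∀ i : Fin N, m ≤ (i : ℕ) → x i = y i then 1 else 0 := by
  have h : embed dloc m N a = fun x y => a (x ∘ Fin.castLE hm) (y ∘ Fin.castLE hm) *
      if ∀ i : Fin N, m ≤ (i : ℕ) → x i = y i then 1 else 0 := dif_pos hm
  rw [h]

lemma Tmat_pow_conj_embed {dloc m N : ℕ} (hm : m ≤ N) (l : ℕ) (a : Op dloc m) :
    Tmat dloc N ^ l * embed dloc m N a * (Tmat dloc N)ᴴ ^ l =
      siteEmbed (shiftedSite hm l) a := by
  rw [Tmat_pow_conj]
  ext x y
  set σ : Equiv.Perm (Fin N) := finRotate N ^ l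
  have hiff : (∀ i : Fin N, m ≤ (i : ℕ) → (x ∘ σ) i = (y ∘ σ) i) ↔
      ∀ i ∉ Set.range (shiftedSite hm l), x i = y i := by
    constructor
    · intro h i hi
      have := h (σ.symm i) (by
        by_contra hlt
        exact hi ⟨⟨σ.symm i, not_le.mp hlt⟩, σ.apply_symm_apply i⟩)
      simpa using this
    · intro h i hi
      refine h (σ i) ?_
      rintro ⟨j, hj⟩
      have hji : Fin.castLE hm j = i := σ.injective hj
      have : (j : ℕ) = i := congrArg Fin.val hji
      exact absurd j.isLt (by omega)
  simp only [Matrix.submatrix_apply, embed_apply hm, siteEmbed]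
  by_cases h : ∀ i ∉ Set.range (shiftedSite hm l), x i = y i
  · rw [if_pos h, if_pos (hiff.mpr h), mul_one]
    rfl
  · rw [if_neg h, if_neg fun h' => h (hiff.mp h'), mul_zero]

/-- For a fixed set of `m` consecutive sites, at most `m ^ 2` of its translates meet it. -/
lemma card_shiftedSite_meet_le {m N : ℕ} (hm : m ≤ N) (l : Fin N) :
    (Finset.univ.filter fun l' : Fin N =>
      ∃ i j, shiftedSite hm l i = shiftedSite hm l' j).card ≤ m ^ 2 := by
  classical
  have hsub : (Finset.univ.filter fun l' : Fin N =>
      ∃ i j, shiftedSite hm l i = shiftedSite hm l' j) ⊆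
      (Finset.univ : Finset (Fin m × Fin m)).biUnion fun p =>
        Finset.univ.filter fun l' : Fin N => shiftedSite hm l p.1 = shiftedSite hm l' p.2 := by
    intro l' hl'
    simpa using hl'
  refine (Finset.card_le_card hsub).trans
    ((Finset.card_biUnion_le_card_mul _ _ 1 fun p _ => ?_).trans ?_)
  · refine Finset.card_le_one.mpr fun u hu v hv => shiftedSite_left_injective hm p.2 ?_
    exact (Finset.mem_filter.mp hu).2.symm.trans (Finset.mem_filter.mp hv).2
  · simp [sq]

lemma trace_conjTranspose_mul_self_smul_sum {n ι : Type*} [Fintype n] [Fintype ι] (r : ℝ)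
    (B : ι → Matrix n n ℂ) :
    ((((r : ℂ) • ∑ l, B l)ᴴ * ((r : ℂ) • ∑ l, B l)).trace).re =
      r ^ 2 * ∑ l, ∑ l', (((B l)ᴴ * B l').trace).re := by
  simp only [Matrix.conjTranspose_smul, Matrix.conjTranspose_sum, Matrix.smul_mul,
    Matrix.mul_smul, Finset.sum_mul_sum, Matrix.trace_smul, Matrix.trace_sum, smul_smul,
    RCLike.star_def, Complex.conj_ofReal, smul_eq_mul, ← Complex.ofReal_mul,
    Complex.re_ofReal_mul, Complex.re_sum, sq]

/-- There is a constant `C`, depending only on `dloc` and `k'`, such that for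
every `N ≥ k'` and every traceless operator `A` on the first `k'` sites with `‖A‖ ≤ 1`, the
translation average `𝔸` satisfies `tr(𝔸†𝔸)/d ≤ C/N`. -/
theorem trace_tavg_le (dloc k' : ℕ) (hdloc : 2 ≤ dloc) :
    ∃ C : ℝ, ∀ N : ℕ, k' ≤ N → ∀ A : Op dloc k', A.trace = 0 → opNorm A ≤ 1 →
      (1 / (dloc : ℝ) ^ N) *
          (((tavg dloc N (embed dloc k' N A))ᴴ * tavg dloc N (embed dloc k' N A)).trace).re ≤
        C / N := by
  refine ⟨(k' : ℝ) ^ 2 * (dloc : ℝ) ^ k', fun N hN A htr hA => ?_⟩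
  have hentry : ∀ u v, ‖A u v‖ ≤ 1 := fun u v => (norm_apply_le_opNorm A u v).trans hA
  have havg : tavg dloc N (embed dloc k' N A) =
      (((N : ℝ)⁻¹ : ℝ) : ℂ) • ∑ l : Fin N, siteEmbed (shiftedSite hN l) A := by
    simp only [tavg, Tmat_pow_conj_embed hN, Complex.ofReal_inv, Complex.ofReal_natCast]
  have hrow : ∀ l : Fin N, ∑ l' : Fin N, (((siteEmbed (shiftedSite hN l) A)ᴴ *
      siteEmbed (shiftedSite hN l') A).trace).re ≤
      (k' : ℝ) ^ 2 * ((dloc : ℝ) ^ N * (dloc : ℝ) ^ k') := by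
    intro l
    calc _ ≤ ∑ l' : Fin N, if ∃ i j, shiftedSite hN l i = shiftedSite hN l' j then
          (dloc : ℝ) ^ N * (dloc : ℝ) ^ k' else 0 := by
          refine Finset.sum_le_sum fun l' _ => ?_
          split_ifs with h
          · refine (Complex.re_le_norm _).trans ?_
            simpa using norm_trace_conjTranspose_siteEmbed_mul_le (shiftedSite hN l)
              (shiftedSite hN l') hentry hentry
          · push Not at h
            rw [trace_conjTranspose_siteEmbed_mul_eq_zero (shiftedSite_injective hN l) h htr,
              Complex.zero_re]
      _ ≤ _ := by
          rw [← Finset.sum_filter, Finset.sum_const, nsmul_eq_mul]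
          gcongr
          exact_mod_cast card_shiftedSite_meet_le hN l
  rw [havg, trace_conjTranspose_mul_self_smul_sum]
  have hd : (0 : ℝ) < (dloc : ℝ) ^ N := by positivity
  calc _ ≤ 1 / (dloc : ℝ) ^ N * ((N : ℝ)⁻¹ ^ 2 *
        ∑ _l : Fin N, (k' : ℝ) ^ 2 * ((dloc : ℝ) ^ N * (dloc : ℝ) ^ k')) := by
        gcongr with l
        exact hrow l
    _ = _ := by
        rw [Finset.sum_const, Finset.card_univ, Fintype.card_fin, nsmul_eq_mul]
        rcases Nat.eq_zero_or_pos N with rfl | hpos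
        · simp
        · field_simp
end
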